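/- arXiv:1903.11244 — 2 statements merged into one kernel-verified Lean document; each statement's English description precedes it below -/
import Mathlib

section
/- Let V be a complex inner product space, let B be a symmetric linear operator on V, and let O be a linear operator on V commuting with B. Let (vₙ)_{n ∈ s} (s a finite index set) be unit eigenvectors of B with real eigenvalues λₙ that are pairwise distinct, and let ψ = Σ_{n ∈ s} cₙ vₙ with cₙ ∈ ℂ. Then ⟪ψ, O ψ⟫ = Σ_{n ∈ s} |cₙ|² ⟪vₙ, O vₙ⟫; i.e., every observable commuting with B takes the same expectation value on the pure state ψ as on the statistical mixture of the eigenstates vₙ with weights |cₙ|². -/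
open scoped ComplexInnerProductSpace

/-- Decoherence into a statistical mixture: every observable `O` commuting with the symmetric
(classicalized) operator `B` takes the same expectation value on the superposition
`ψ = ∑ n ∈ s, cₙ • vₙ` of unit eigenvectors of `B` with pairwise distinct real eigenvalues as on
the statistical mixture of the eigenstates `vₙ` with weights `|cₙ|²`. -/
theorem expectation_eq_mixture_of_commute
    {V : Type*} [NormedAddCommGroup V] [InnerProductSpace ℂ V]
    {ι : Type*} (s : Finset ι)
    (B O : V →ₗ[ℂ] V)
    (hB : ∀ x y : V, ⟪B x, y⟫ = ⟪x, B y⟫)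
    (hcomm : O ∘ₗ B = B ∘ₗ O)
    (v : ι → V) (lam : ι → ℝ) (c : ι → ℂ)
    (hunit : ∀ n ∈ s, ‖v n‖ = 1)
    (heig : ∀ n ∈ s, B (v n) = (lam n : ℂ) • v n)
    (hdist : ∀ n ∈ s, ∀ m ∈ s, n ≠ m → lam n ≠ lam m)
    (ψ : V) (hψ : ψ = ∑ n ∈ s, c n • v n) :
    ⟪ψ, O ψ⟫ = ∑ n ∈ s, (‖c n‖ : ℂ) ^ 2 * ⟪v n, O (v n)⟫ := by
  have key : ∀ n ∈ s, ∀ m ∈ s, n ≠ m → ⟪v n, O (v m)⟫ = 0 := by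
    intro n hn m hm hnm
    have h1 := hB (v n) (O (v m))
    have h2 : B (O (v m)) = (lam m : ℂ) • O (v m) := by
      have h3 := LinearMap.congr_fun hcomm (v m)
      simp only [LinearMap.comp_apply] at h3
      rw [← h3, heig m hm, map_smul]
    rw [heig n hn, h2, inner_smul_left, inner_smul_right, Complex.conj_ofReal] at h1
    have h4 : (lam n : ℂ) ≠ (lam m : ℂ) := by
      exact_mod_cast hdist n hn m hm hnm
    by_contra h0
    exact h4 (mul_right_cancel₀ h0 h1)
  subst hψ
  rw [map_sum, sum_inner]
  refine Finset.sum_congr rfl fun n hn => ?_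
  rw [inner_sum, Finset.sum_eq_single_of_mem n hn]
  · rw [map_smul, inner_smul_left, inner_smul_right, ← mul_assoc, Complex.conj_mul']
  · intro m hm hmn
    rw [map_smul, inner_smul_left, inner_smul_right, key n hn m hm hmn.symm]
    simp
end

section
/- Let l > 0 and 0 < ε < l/2, and set a = l/2. The hyperbolic area of the region enclosed by the geodesic semicircle of diameter l and the cutoff line z = ε, namely the integral of 1/z² with respect to two-dimensional Lebesgue measure over the set {(w, z) ∈ ℝ² : (w − a)² + z² ≤ a² and z ≥ ε}, equals (2/ε)·√(a² − ε²) − 2·arcsin(√(a² − ε²)/a). -/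
open MeasureTheory

/-- The hyperbolic area (with area element `dw dz / z²`) of the region enclosed by the
Ryu–Takayanagi geodesic semicircle `(w − a)² + z² = a²` (with `a = l/2`) and the ultraviolet
cutoff line `z = ε` equals `(2/ε)√(a² − ε²) − 2 arcsin(√(a² − ε²)/a)`. -/
theorem rt_region_hyperbolic_area
    (l ε a : ℝ) (hl : 0 < l) (hε : 0 < ε) (hεl : ε < l / 2) (ha : a = l / 2) :
    (∫ x in {p : ℝ × ℝ | (p.1 - a) ^ 2 + p.2 ^ 2 ≤ a ^ 2 ∧ ε ≤ p.2},
        (1 / x.2 ^ 2)) =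
      (2 / ε) * Real.sqrt (a ^ 2 - ε ^ 2) -
        2 * Real.arcsin (Real.sqrt (a ^ 2 - ε ^ 2) / a) := by
  have ha0 : 0 < a := by linarith
  have hεa : ε < a := by linarith
  clear ha hl hεl
  set S : Set (ℝ × ℝ) := {p : ℝ × ℝ | (p.1 - a) ^ 2 + p.2 ^ 2 ≤ a ^ 2 ∧ ε ≤ p.2} with hS
  have hclosed : IsClosed S := by
    have h1 : IsClosed {p : ℝ × ℝ | (p.1 - a) ^ 2 + p.2 ^ 2 ≤ a ^ 2} :=
      isClosed_le (by fun_prop) (by fun_prop)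
    have h2 : IsClosed {p : ℝ × ℝ | ε ≤ p.2} := isClosed_le (by fun_prop) (by fun_prop)
    exact h1.inter h2
  have hsub : S ⊆ Set.Icc 0 (2 * a) ×ˢ Set.Icc ε a := by
    rintro ⟨w, z⟩ ⟨h1, h2⟩
    simp only at h1 h2
    have h3 := abs_le_of_sq_le_sq' (a := w - a) (b := a) (by nlinarith) ha0.le
    have h4 := abs_le_of_sq_le_sq' (a := z) (b := a) (by nlinarith) ha0.le
    exact ⟨⟨by linarith, by linarith⟩, ⟨h2, h4.2⟩⟩
  have hcomp : IsCompact S :=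
    (isCompact_Icc.prod isCompact_Icc).of_isClosed_subset hclosed hsub
  have hint : IntegrableOn (fun x : ℝ × ℝ => 1 / x.2 ^ 2) S := by
    apply ContinuousOn.integrableOn_compact hcomp
    apply ContinuousOn.div (by fun_prop) (by fun_prop)
    rintro ⟨w, z⟩ ⟨h1, h2⟩
    simp only at h2
    have : 0 < z := by linarith
    positivity
  rw [← integral_indicator hclosed.measurableSet, Measure.volume_eq_prod,
    integral_prod_symm _ (by
      rw [← Measure.volume_eq_prod]
      exact (integrable_indicator_iff hclosed.measurableSet).2 hint)]
  have hinner : ∀ z : ℝ, (∫ w : ℝ, S.indicator (fun x : ℝ × ℝ => 1 / x.2 ^ 2) (w, z)) =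
      (Set.Icc ε a).indicator (fun z => 2 * √(a ^ 2 - z ^ 2) / z ^ 2) z := by
    intro z
    by_cases hz : z ∈ Set.Icc ε a
    · rw [Set.indicator_of_mem hz]
      have hnn : 0 ≤ a ^ 2 - z ^ 2 := by nlinarith [hz.1, hz.2]
      have : (fun w : ℝ => S.indicator (fun x : ℝ × ℝ => 1 / x.2 ^ 2) (w, z)) =
          (Set.Icc (a - √(a ^ 2 - z ^ 2)) (a + √(a ^ 2 - z ^ 2))).indicator
            (fun _ => 1 / z ^ 2) := by
        funext w
        have hiff : (w, z) ∈ S ↔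
            w ∈ Set.Icc (a - √(a ^ 2 - z ^ 2)) (a + √(a ^ 2 - z ^ 2)) := by
          have h : |w - a| ≤ √(a ^ 2 - z ^ 2) ↔ (w - a) ^ 2 ≤ a ^ 2 - z ^ 2 := by
            rw [Real.le_sqrt (abs_nonneg _), sq_abs]; exact hnn
          simp only [hS, Set.mem_ofPred_eq, Set.mem_Icc]
          rw [abs_le] at h
          constructor
          · rintro ⟨h1, -⟩
            have := h.2 (by linarith)
            constructor <;> linarith
          · rintro ⟨h1, h2⟩
            have := h.1 ⟨by linarith, by linarith⟩
            exact ⟨by linarith, hz.1⟩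
        by_cases hw : (w, z) ∈ S
        · rw [Set.indicator_of_mem hw, Set.indicator_of_mem (hiff.1 hw)]
        · rw [Set.indicator_of_notMem hw, Set.indicator_of_notMem (fun h => hw (hiff.2 h))]
      rw [this, integral_indicator measurableSet_Icc, setIntegral_const]
      rw [measureReal_def, Real.volume_Icc, ENNReal.toReal_ofReal (by
        have := Real.sqrt_nonneg (a ^ 2 - z ^ 2); linarith), smul_eq_mul]
      ring
    · rw [Set.indicator_of_notMem hz]
      have : ∀ w : ℝ, S.indicator (fun x : ℝ × ℝ => 1 / x.2 ^ 2) (w, z) = 0 := fun w =>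
        Set.indicator_of_notMem (fun h => hz (hsub h).2) _
      simp only [this, integral_zero]
  simp_rw [hinner]
  rw [integral_indicator measurableSet_Icc, integral_Icc_eq_integral_Ioc,
    ← intervalIntegral.integral_of_le hεa.le]
  have hne : ∀ z ∈ Set.Icc ε a, z ≠ 0 := fun z hz => by linarith [hz.1] |> fun h : 0 < z => h.ne'
  have hftc := intervalIntegral.integral_eq_sub_of_hasDerivAt_of_le
    (f := fun z => -2 * (√(a ^ 2 - z ^ 2) / z) - 2 * Real.arcsin (z / a))
    (f' := fun z => 2 * √(a ^ 2 - z ^ 2) / z ^ 2) hεa.le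
    (by
      apply ContinuousOn.sub
      · exact continuousOn_const.mul (ContinuousOn.div (by fun_prop) (by fun_prop) hne)
      · exact (continuous_const.mul (Real.continuous_arcsin.comp
          (continuous_id.div_const a))).continuousOn)
    (by
      intro z hz
      have hz0 : 0 < z := by linarith [hz.1]
      have hp : 0 < a ^ 2 - z ^ 2 := by nlinarith [hz.1, hz.2]
      have hza : z / a < 1 := (div_lt_one ha0).2 hz.2
      have hza0 : 0 < z / a := by positivity
      have h1 := ((((hasDerivAt_id z).pow 2).const_sub (a ^ 2)).sqrt hp.ne').div
        (hasDerivAt_id z) hz0.ne'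
      have h2 := (Real.hasDerivAt_arcsin (x := z / a) (by linarith) hza.ne).comp z
        ((hasDerivAt_id z).div_const a)
      have h3 := (h1.const_mul (-2)).sub (h2.const_mul 2)
      have hs : √(1 - (z / a) ^ 2) = √(a ^ 2 - z ^ 2) / a := by
        have e : 1 - (z / a) ^ 2 = (a ^ 2 - z ^ 2) / a ^ 2 := by field_simp
        rw [e, Real.sqrt_div hp.le, Real.sqrt_sq ha0.le]
      refine h3.congr_deriv ?_
      have hr : 0 < √(a ^ 2 - z ^ 2) := Real.sqrt_pos.2 hp
      have hr2 := Real.sq_sqrt hp.le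
      simp only [id, Pi.pow_apply]
      rw [hs]
      field_simp
      norm_num
      try nlinarith)
    (by
      apply ContinuousOn.intervalIntegrable_of_Icc hεa.le
      exact ContinuousOn.div (by fun_prop) (by fun_prop) (fun z hz => pow_ne_zero 2 (hne z hz)))
  rw [hftc]
  have hA : Real.arcsin (√(a ^ 2 - ε ^ 2) / a) = Real.pi / 2 - Real.arcsin (ε / a) := by
    rw [← Real.arccos_eq_pi_div_two_sub_arcsin, Real.arccos_eq_arcsin (by positivity)]
    congr 1
    have hp : 0 < a ^ 2 - ε ^ 2 := by nlinarith
    have e : 1 - (ε / a) ^ 2 = (a ^ 2 - ε ^ 2) / a ^ 2 := by field_simp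
    rw [e, Real.sqrt_div hp.le, Real.sqrt_sq ha0.le]
  rw [hA]
  simp only [sub_self, Real.sqrt_zero, div_self ha0.ne', Real.arcsin_one]
  ring
end
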